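/- Let R be a commutative ring, N ≥ 1, λ a partition of length ≤ N (extended by zeros), and x₁,…,x_N ∈ R (or indeterminates). Then det [h_{λ_j−j+k}(x₁,…,x_N)]_{j,k=1}^N = det [h_{λ_j−j+k}(x_k, x_{k+1}, …, x_N)]_{j,k=1}^N; that is, the Jacobi–Trudi determinant equals the determinant of the matrix in which the k-th column uses only the variables x_k,…,x_N. -/

import Mathlib

open scoped BigOperators

/-- Complete homogeneous polynomial of degree `m` evaluated at the list `l`
(`h₀ = 1`, `h_m = 0` for `m < 0`). -/
def homEval {R : Type*} [CommRing R] (l : List R) (m : ℤ) : R :=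
  if 0 ≤ m then
    ∑ f ∈ Finset.Nat.antidiagonalTuple l.length m.toNat, ∏ i, l.get i ^ f i
  else 0

/-- Elementary symmetric polynomial of degree `k` evaluated at the list `l`. -/
def esymmEval {R : Type*} [CommRing R] (l : List R) (k : ℕ) : R :=
  (((l : Multiset R).powersetCard k).map Multiset.prod).sum

/-- Power sum of degree `s` evaluated at the list `l`. -/
def psumEval {R : Type*} [CommRing R] (l : List R) (s : ℕ) : R :=
  (l.map (· ^ s)).sum

/-- The list `y^[κ]`: `y q` repeated `κ q` times, in order. -/
def repList {R : Type*} {n : ℕ} (y : Fin n → R) (κ : Fin n → ℕ) : List R :=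
  (List.ofFn fun q => List.replicate (κ q) (y q)).flatten

/-- Zero-based version of `γ(κ, p) = (q, r)`: the `p`-th entry (0-based) of the list
    `(0,0),…,(0,κ₀−1),(1,0),…,(1,κ₁−1),…`. -/
def gammaPair (n : ℕ) (κ : Fin n → ℕ) (p : ℕ) : ℕ × ℕ :=
  ((List.ofFn fun q : Fin n => (List.range (κ q)).map fun r => ((q : ℕ), r)).flatten).getD p (0, 0)

/-- The generalized confluent Vandermonde matrix `G_λ(y, κ)` (zero-based indices):
`G[j,p] = binom(N+λ_j−j−1, r) · y_q^(N+λ_j−j−r−1)` if the exponent is `≥ 0`, else `0`,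
where `(q, r) = gammaPair n κ p`. -/
def vanG (R : Type*) [CommRing R] {n : ℕ} (N : ℕ) (κ : Fin n → ℕ) (y : Fin n → R)
    (lam : Fin N → ℕ) : Matrix (Fin N) (Fin N) R :=
  Matrix.of fun j p =>
    if h : (gammaPair n κ (p : ℕ)).1 < n ∧
        (j : ℕ) + (gammaPair n κ (p : ℕ)).2 + 1 ≤ N + lam j then
      (Nat.choose (N + lam j - ((j : ℕ) + 1)) (gammaPair n κ (p : ℕ)).2 : R) *
        y ⟨(gammaPair n κ (p : ℕ)).1, h.1⟩ ^
          (N + lam j - ((j : ℕ) + (gammaPair n κ (p : ℕ)).2 + 1))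
    else 0

/-- The Jacobi–Trudi matrix `J_λ(x) = [h_{λ_j − j + k}(x)]`. -/
def jacobiTrudi (R : Type*) [CommRing R] (N : ℕ) (lam : Fin N → ℕ) (x : List R) :
    Matrix (Fin N) (Fin N) R :=
  Matrix.of fun j k => homEval x ((lam j : ℤ) - (j : ℕ) + (k : ℕ))

/-- The matrix `M(y, κ)` with entries `(−1)^{N−k−r+1} e_{N−k−r+1}(y^[κ − r b_q])`
(in one-based form); entries with `N−k−r+1 < 0` are `0`. -/
def matM (R : Type*) [CommRing R] {n : ℕ} (N : ℕ) (κ : Fin n → ℕ) (y : Fin n → R) :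
    Matrix (Fin N) (Fin N) R :=
  Matrix.of fun k p =>
    if h : (gammaPair n κ (p : ℕ)).1 < n ∧
        (k : ℕ) + (gammaPair n κ (p : ℕ)).2 + 1 ≤ N then
      (-1 : R) ^ (N - ((k : ℕ) + (gammaPair n κ (p : ℕ)).2 + 1)) *
        esymmEval
          (repList y (Function.update κ ⟨(gammaPair n κ (p : ℕ)).1, h.1⟩
            (κ ⟨(gammaPair n κ (p : ℕ)).1, h.1⟩ - ((gammaPair n κ (p : ℕ)).2 + 1))))
          (N - ((k : ℕ) + (gammaPair n κ (p : ℕ)).2 + 1))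
    else 0

/-- The column vector `H^N_{s,λ}(l) = (h_{s + λ_j − j}(l))_{j=1}^N` (one-based `j`). -/
def Hcol {R : Type*} [CommRing R] {N : ℕ} (lam : Fin N → ℕ) (s : ℕ) (l : List R) :
    Fin N → R :=
  fun j => homEval l ((s : ℤ) + lam j - ((j : ℕ) + 1))

theorem homEval_of_neg {R : Type*} [CommRing R] (l : List R) {m : ℤ} (hm : m < 0) :
    homEval l m = 0 :=
  if_neg hm.not_ge

theorem homEval_natCast {R : Type*} [CommRing R] (l : List R) (n : ℕ) :
    homEval l (n : ℤ) =
      ∑ f ∈ Finset.Nat.antidiagonalTuple l.length n, ∏ i, l.get i ^ f i := by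
  simp [homEval]

theorem homEval_cons_natCast {R : Type*} [CommRing R] (a : R) (l : List R) (n : ℕ) :
    homEval (a :: l) (n : ℤ) =
      ∑ p ∈ Finset.HasAntidiagonal.antidiagonal n, a ^ p.1 * homEval l (p.2 : ℤ) := by
  have key : ∀ F : (Fin (l.length + 1) → ℕ) → R,
      ∑ f ∈ Finset.Nat.antidiagonalTuple (l.length + 1) n, F f =
        ∑ p ∈ Finset.HasAntidiagonal.antidiagonal n,
          ∑ f ∈ Finset.Nat.antidiagonalTuple l.length p.2, F (Fin.cons p.1 f) := by
    intro F
    change ((List.Nat.antidiagonalTuple (l.length + 1) n).map F).sum =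
      ((List.Nat.antidiagonal n).map fun p =>
        ((List.Nat.antidiagonalTuple l.length p.2).map fun f => F (Fin.cons p.1 f)).sum).sum
    rw [List.Nat.antidiagonalTuple, List.map_flatMap, List.flatMap_def, List.sum_flatten]
    simp only [List.map_map, Function.comp_def]
  rw [homEval_natCast]
  refine (key _).trans (Finset.sum_congr rfl fun p _ => ?_)
  rw [homEval_natCast, Finset.mul_sum]
  refine Finset.sum_congr rfl fun f _ => ?_
  exact Fin.prod_univ_succ _

theorem homEval_cons {R : Type*} [CommRing R] (a : R) (l : List R) (m : ℤ) :
    homEval (a :: l) m = homEval l m + a * homEval (a :: l) (m - 1) := by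
  rcases lt_or_ge m 0 with hm | hm
  · simp [homEval_of_neg _ hm, homEval_of_neg _ (show m - 1 < 0 by omega)]
  lift m to ℕ using hm
  cases m with
  | zero =>
    rw [homEval_cons_natCast, homEval_of_neg (a :: l) (m := ((0 : ℕ) : ℤ) - 1) (by simp)]
    simp
  | succ n =>
    have hn : ((n + 1 : ℕ) : ℤ) - 1 = n := by simp
    rw [hn, homEval_cons_natCast, homEval_cons_natCast, Finset.Nat.sum_antidiagonal_succ,
      Finset.mul_sum]
    simp only [pow_zero, one_mul, pow_succ', mul_assoc]

/-- Dropping one more variable from every column past the `t`-th is a column operation. -/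
theorem det_homEval_drop_min_succ {R : Type*} [CommRing R] (n : ℕ) (a : Fin (n + 1) → ℤ)
    (l : List R) (t : ℕ) (ht : t < l.length) :
    Matrix.det (Matrix.of fun j k : Fin (n + 1) =>
        homEval (l.drop (min (k : ℕ) t)) (a j + (k : ℕ))) =
      Matrix.det (Matrix.of fun j k : Fin (n + 1) =>
        homEval (l.drop (min (k : ℕ) (t + 1))) (a j + (k : ℕ))) := by
  refine Matrix.det_eq_of_forall_col_eq_smul_add_pred
    (fun k => if t ≤ (k : ℕ) then l[t] else 0) (fun j => by simp) fun j k => ?_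
  simp only [Matrix.of_apply, Fin.val_succ, Fin.val_castSucc]
  split_ifs with hk
  · rw [min_eq_right (by omega), min_eq_right (by omega), min_eq_right hk,
      List.drop_eq_getElem_cons ht, homEval_cons]
    congr 3
    push_cast
    ring
  · rw [min_eq_left (by omega), min_eq_left (by omega), zero_mul, add_zero]

/-- partial reduction of the Jacobi–Trudi determinant: the `k`-th column
may use only the variables `x_k, …, x_N`. -/
theorem jacobiTrudi_partial_reduction {R : Type*} [CommRing R]
    (N : ℕ) (hN : 1 ≤ N) (lam : Fin N → ℕ) (hlam : Antitone lam) (x : Fin N → R) :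
    Matrix.det (Matrix.of fun j k : Fin N =>
        homEval (List.ofFn x) ((lam j : ℤ) - (j : ℕ) + (k : ℕ))) =
      Matrix.det (Matrix.of fun j k : Fin N =>
        homEval ((List.ofFn x).drop (k : ℕ)) ((lam j : ℤ) - (j : ℕ) + (k : ℕ))) := by
  obtain ⟨n, rfl⟩ : ∃ n, N = n + 1 := ⟨N - 1, by omega⟩
  have key : ∀ t ≤ n + 1,
      Matrix.det (Matrix.of fun j k : Fin (n + 1) =>
          homEval (List.ofFn x) ((lam j : ℤ) - (j : ℕ) + (k : ℕ))) =
        Matrix.det (Matrix.of fun j k : Fin (n + 1) =>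
          homEval ((List.ofFn x).drop (min (k : ℕ) t)) ((lam j : ℤ) - (j : ℕ) + (k : ℕ))) := by
    intro t
    induction t with
    | zero => simp
    | succ t ih =>
      intro ht
      exact (ih (by omega)).trans
        (det_homEval_drop_min_succ n (fun j => (lam j : ℤ) - (j : ℕ)) _ t (by simpa using ht))
  rw [key (n + 1) le_rfl]
  simp only [min_eq_left (Fin.is_lt _).le]
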